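/- (Error of the cut-and-pile construction.) In the cut-and-pile setup — d ≥ 2, η uniform on d outcomes, p, q ∈ ℝ^d with D(p‖η) > 0, D(q‖η) > 0, V(p‖η) > 0, V(q‖η) > 0, (t_n) a moderate sequence, μ ≠ 0 (with ν ≠ 1 if μ < 0), m_n = ⌊n·(D(p‖η) + μ t_n)/D(q‖η)⌋, P^n = (p^{⊗n} ⊗ η^{⊗m_n})^↓, Q^n = (q^{⊗m_n} ⊗ η^{⊗n})^↓, K_n(x) = exp( H(Q^n) + x·n·t_n ), ν = (V(p‖η)/D(p‖η))/(V(q‖η)/D(q‖η)), z_C = μ/(1 − √ν), z_T = μ/(1 + √ν), z_{μ,ν} = 2μ − z_C if μ < 0, ν < 1; z_C if μ < 0, ν > 1; z_T if μ > 0; and, for sufficiently small ζ > 0, P̃^{(μ)} the cut-and-pile modification of P^n with cut at K_n(z_{μ,ν} − ζ) — the following hold: (i) if μ < 0, there exists N such that for all n ≥ N, δ(P̃^{(μ)}, P^n) < exp( −((z_{μ,ν} − μ − 2ζ)² / (2 V(p‖η))) · n t_n² ); and (ii) if μ > 0, there exists N such that for all n ≥ N, δ(P̃^{(μ)}, P^n)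 < 1 − exp( −((z_{μ,ν} − μ − 2ζ)² / (2 V(p‖η))) · n t_n² ). -/

import Mathlib

open Finset Filter Real Topology

noncomputable section

/-- A probability distribution on a finite type: nonnegative entries summing to 1. -/
def IsProbDist {α : Type*} [Fintype α] (a : α → ℝ) : Prop :=
  (∀ i, 0 ≤ a i) ∧ ∑ i, a i = 1

/-- A sharp distribution: a single entry equal to 1, all others 0. -/
def IsSharp {α : Type*} [Fintype α] (a : α → ℝ) : Prop :=
  ∃ i, a i = 1 ∧ ∀ j, j ≠ i → a j = 0

/-- The uniform distribution: all entries equal to `1 / |α|`. -/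
def IsUniform {α : Type*} [Fintype α] (a : α → ℝ) : Prop :=
  ∀ i, a i = 1 / (Fintype.card α : ℝ)

/-- Tensor (Kronecker) product of two vectors. -/
def tensor {α β : Type*} (a : α → ℝ) (b : β → ℝ) : α × β → ℝ :=
  fun x => a x.1 * b x.2

/-- `n`-fold tensor power of a vector. -/
def tpow {α : Type*} (a : α → ℝ) (n : ℕ) : (Fin n → α) → ℝ :=
  fun f => ∏ j, a (f j)

/-- Shannon entropy (natural logarithm, with the convention `0 · ln 0 = 0`). -/
def shannonH {α : Type*} [Fintype α] (a : α → ℝ) : ℝ :=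
  -∑ i, a i * Real.log (a i)

/-- Entropy variance `V(a) = ∑ i, a i (ln a i + H(a))²`. -/
def entV {α : Type*} [Fintype α] (a : α → ℝ) : ℝ :=
  ∑ i, a i * (Real.log (a i) + shannonH a) ^ 2

/-- Relative entropy `D(a‖b)`. -/
def relD {α : Type*} [Fintype α] (a b : α → ℝ) : ℝ :=
  ∑ i, a i * Real.log (a i / b i)

/-- Relative entropy variance `V(a‖b)`. -/
def relV {α : Type*} [Fintype α] (a b : α → ℝ) : ℝ :=
  ∑ i, a i * (Real.log (a i / b i) - relD a b) ^ 2

/-- Total variation distance. -/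
def tvd {α : Type*} [Fintype α] (a b : α → ℝ) : ℝ :=
  (1 / 2) * ∑ i, |a i - b i|

/-- Fidelity `F(a,b) = (∑ i √(a i · b i))²`. -/
def fid {α : Type*} [Fintype α] (a b : α → ℝ) : ℝ :=
  (∑ i, Real.sqrt (a i * b i)) ^ 2

/-- The entries of `a` sorted in non-increasing order, as a vector on `Fin (card α)`. -/
def descSorted {α : Type*} [Fintype α] (a : α → ℝ) : Fin (Fintype.card α) → ℝ :=
  fun i =>
    a ((Fintype.equivFin α).symm
      (Tuple.sort (fun j => -a ((Fintype.equivFin α).symm j)) i))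

/-- `headSum a K = ∑_{1 ≤ i ≤ K} a^↓_i` (1-based indices `i`, comparison `(i : ℝ) ≤ K`,
equivalently `i ≤ ⌊K⌋`). -/
def headSum {α : Type*} [Fintype α] (a : α → ℝ) (K : ℝ) : ℝ :=
  ∑ i ∈ Finset.univ.filter (fun i : Fin (Fintype.card α) => ((i : ℕ) + 1 : ℝ) ≤ K),
    descSorted a i

/-- `tailSum a K = ∑_{i ≥ K} a^↓_i` (1-based indices `i`, comparison `K ≤ (i : ℝ)`,
equivalently `i ≥ ⌈K⌉`). -/
def tailSum {α : Type*} [Fintype α] (a : α → ℝ) (K : ℝ) : ℝ :=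
  ∑ i ∈ Finset.univ.filter (fun i : Fin (Fintype.card α) => K ≤ ((i : ℕ) + 1 : ℝ)),
    descSorted a i

/-- `a` majorises `b` (written `a ≻ b`): every partial sum of the non-increasingly sorted
`a` dominates the corresponding partial sum of sorted `b` (shorter vectors padded with zeros). -/
def Maj {α β : Type*} [Fintype α] [Fintype β] (a : α → ℝ) (b : β → ℝ) : Prop :=
  ∀ j : ℕ, headSum b (j : ℝ) ≤ headSum a (j : ℝ)

/-- `a ≻_ε b`: approximate majorisation (from above) with total variation error:
there is a probability distribution `b̃` with `a ≻ b̃` and `δ(b, b̃) ≤ ε`. -/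
def ApproxMajTV {α β : Type*} [Fintype α] [Fintype β] (a : α → ℝ) (b : β → ℝ) (ε : ℝ) : Prop :=
  ∃ bt : β → ℝ, IsProbDist bt ∧ Maj a bt ∧ tvd b bt ≤ ε

/-- `a ≺_ε b`: approximate majorisation (from below) with total variation error:
there is a probability distribution `b̃` with `a ≺ b̃` and `δ(b, b̃) ≤ ε`. -/
def ApproxSubMajTV {α β : Type*} [Fintype α] [Fintype β] (a : α → ℝ) (b : β → ℝ) (ε : ℝ) : Prop :=
  ∃ bt : β → ℝ, IsProbDist bt ∧ Maj bt a ∧ tvd b bt ≤ ε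

/-- A moderate sequence: `t n → 0` and `√n · t n → +∞`. -/
def ModerateSeq (t : ℕ → ℝ) : Prop :=
  Tendsto t atTop (𝓝 0) ∧ Tendsto (fun n : ℕ => Real.sqrt (n : ℝ) * t n) atTop atTop

/-- The uniform distribution on `Fin d`. -/
def unif (d : ℕ) : Fin d → ℝ := fun _ => 1 / (d : ℝ)

/-- The embedding map `Γ` associated with `γ_i = c_i / N`: for each `i` it produces
`c_i` entries equal to `a_i / c_i`. -/
def embed {d : ℕ} (c : Fin d → ℕ) (a : Fin d → ℝ) : (Σ i : Fin d, Fin (c i)) → ℝ :=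
  fun x => a x.1 / (c x.1 : ℝ)

/-- Cut-and-pile modification of the sorted version of `a`, with cut at `K`:
the first entry absorbs the total mass of entries at (1-based) positions `≥ K`,
entries at positions `1 < i < K` are unchanged, and entries at positions `≥ K` are set to 0. -/
def cutAndPile {α : Type*} [Fintype α] (a : α → ℝ) (K : ℝ) : Fin (Fintype.card α) → ℝ :=
  fun i =>
    if (i : ℕ) = 0 then descSorted a i + tailSum a K
    else if ((i : ℕ) + 1 : ℝ) < K then descSorted a i else 0

/-- Sorting only permutes the entries. -/
theorem exists_descSorted_eq_comp {α : Type*} [Fintype α] (a : α → ℝ) :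
    ∃ e : Fin (Fintype.card α) ≃ α, descSorted a = a ∘ e :=
  ⟨(Tuple.sort (fun j => -a ((Fintype.equivFin α).symm j))).trans (Fintype.equivFin α).symm, rfl⟩

theorem antitone_descSorted {α : Type*} [Fintype α] (a : α → ℝ) : Antitone (descSorted a) := by
  intro i j hij
  have h := Tuple.monotone_sort (fun j => -a ((Fintype.equivFin α).symm j)) hij
  simpa [descSorted] using h

theorem succ_mul_descSorted_le_one {α : Type*} [Fintype α] {a : α → ℝ} (ha : IsProbDist a)
    (i : Fin (Fintype.card α)) : ((i : ℕ) + 1 : ℝ) * descSorted a i ≤ 1 := by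
  obtain ⟨e, he⟩ := exists_descSorted_eq_comp a
  calc ((i : ℕ) + 1 : ℝ) * descSorted a i = ∑ j ∈ Finset.Iic i, descSorted a i := by
        simp [Fin.card_Iic]
    _ ≤ ∑ j ∈ Finset.Iic i, descSorted a j :=
        Finset.sum_le_sum fun j hj => antitone_descSorted a (Finset.mem_Iic.1 hj)
    _ ≤ ∑ j, descSorted a j :=
        Finset.sum_le_sum_of_subset_of_nonneg (Finset.subset_univ _)
          fun j _ _ => by rw [he]; exact ha.1 _
    _ = 1 := by rw [he, ← ha.2]; exact Equiv.sum_comp e a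

/-- The tail beyond position `K` is carried by outcomes of probability at most `1 / K`. -/
theorem tailSum_le_sum_filter {α : Type*} [Fintype α] {a : α → ℝ} (ha : IsProbDist a)
    {K : ℝ} (hK : 0 < K) :
    tailSum a K ≤ ∑ x ∈ Finset.univ.filter (fun x => a x ≤ 1 / K), a x := by
  obtain ⟨e, he⟩ := exists_descSorted_eq_comp a
  have h : ∑ x ∈ Finset.univ.filter (fun x => a x ≤ 1 / K), a x =
      ∑ i ∈ Finset.univ.filter (fun i => descSorted a i ≤ 1 / K), descSorted a i := by
    rw [Finset.sum_filter, Finset.sum_filter, he]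
    exact (Equiv.sum_comp e (fun x => if a x ≤ 1 / K then a x else 0)).symm
  rw [h]
  refine Finset.sum_le_sum_of_subset_of_nonneg ?_ fun j _ _ => by rw [he]; exact ha.1 _
  intro i hi
  simp only [Finset.mem_filter, Finset.mem_univ, true_and] at hi ⊢
  have h0 : 0 ≤ descSorted a i := by rw [he]; exact ha.1 _
  rw [le_div_iff₀ hK]
  nlinarith [succ_mul_descSorted_le_one ha i]

theorem tvd_cutAndPile_le_tailSum {α : Type*} [Fintype α] {a : α → ℝ} (ha : IsProbDist a)
    (K : ℝ) : tvd (cutAndPile a K) (descSorted a) ≤ tailSum a K := by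
  obtain ⟨e, he⟩ := exists_descSorted_eq_comp a
  have h0 : ∀ i, 0 ≤ descSorted a i := fun i => by rw [he]; exact ha.1 _
  have hT : 0 ≤ tailSum a K := Finset.sum_nonneg fun i _ => h0 i
  have key : ∀ i : Fin (Fintype.card α), |cutAndPile a K i - descSorted a i| ≤
      (if (i : ℕ) = 0 then tailSum a K else 0) +
        (if K ≤ ((i : ℕ) + 1 : ℝ) then descSorted a i else 0) := by
    intro i
    unfold cutAndPile
    by_cases hi : (i : ℕ) = 0
    · rw [if_pos hi, if_pos hi, add_sub_cancel_left, abs_of_nonneg hT]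
      have := h0 i
      split_ifs <;> linarith
    · rw [if_neg hi, if_neg hi]
      by_cases hk : K ≤ ((i : ℕ) + 1 : ℝ)
      · rw [if_neg (not_lt.2 hk), if_pos hk, zero_sub, abs_neg, abs_of_nonneg (h0 i), zero_add]
      · rw [if_pos (not_le.1 hk), if_neg hk]; simp
  have hfirst : ∑ i : Fin (Fintype.card α), (if (i : ℕ) = 0 then tailSum a K else 0) ≤
      tailSum a K := by
    rw [← Finset.sum_filter, Finset.sum_const, nsmul_eq_mul]
    have : (Finset.univ.filter fun i : Fin (Fintype.card α) => (i : ℕ) = 0).card ≤ 1 := by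
      rw [Finset.card_le_one]
      intro x hx y hy
      simp only [Finset.mem_filter, Finset.mem_univ, true_and] at hx hy
      exact Fin.ext (hx.trans hy.symm)
    have h1 : ((Finset.univ.filter fun i : Fin (Fintype.card α) => (i : ℕ) = 0).card : ℝ) ≤ 1 := by
      exact_mod_cast this
    nlinarith
  have hsum := Finset.sum_le_sum fun i (_ : i ∈ Finset.univ) => key i
  rw [Finset.sum_add_distrib, ← Finset.sum_filter (fun i : Fin (Fintype.card α) =>
    K ≤ ((i : ℕ) + 1 : ℝ))] at hsum
  change _ ≤ _ + tailSum a K at hsum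
  unfold tvd
  linarith

/-! ### Moments of product distributions -/

theorem sum_pi_succ {α : Type*} [Fintype α] {n : ℕ} (F : (Fin (n + 1) → α) → ℝ) :
    ∑ f, F f = ∑ i, ∑ f : Fin n → α, F (Fin.cons i f) := by
  rw [← Fintype.sum_prod_type']
  exact (Equiv.sum_comp (Fin.consEquiv fun _ : Fin (n + 1) => α) F).symm

theorem IsProbDist.tpow {α : Type*} [Fintype α] {a : α → ℝ} (ha : IsProbDist a) (n : ℕ) :
    IsProbDist (tpow a n) := by
  refine ⟨fun f => Finset.prod_nonneg fun j _ => ha.1 _, ?_⟩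
  have := Fintype.sum_pow a n
  rw [ha.2, one_pow] at this
  exact this.symm

theorem IsProbDist.tensor {α β : Type*} [Fintype α] [Fintype β] {a : α → ℝ} {b : β → ℝ}
    (ha : IsProbDist a) (hb : IsProbDist b) : IsProbDist (tensor a b) := by
  refine ⟨fun x => mul_nonneg (ha.1 _) (hb.1 _), ?_⟩
  rw [Fintype.sum_prod_type]
  simp only [_root_.tensor, ← Finset.mul_sum, hb.2, ha.2, mul_one]

theorem isProbDist_unif {d : ℕ} (hd : d ≠ 0) : IsProbDist (unif d) := by
  refine ⟨fun i => by unfold unif; positivity, ?_⟩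
  simp [unif, hd]

theorem sum_tpow_mul_sum {α : Type*} [Fintype α] {a : α → ℝ} (ha : IsProbDist a) (u : α → ℝ)
    (n : ℕ) : ∑ f, tpow a n f * ∑ j, u (f j) = n * ∑ i, a i * u i := by
  induction n with
  | zero => simp
  | succ n ih =>
    rw [sum_pi_succ]
    have h : ∀ i, ∑ f : Fin n → α, tpow a (n + 1) (Fin.cons i f) *
        ∑ j, u ((Fin.cons i f : Fin (n + 1) → α) j) = a i * u i + a i * (n * ∑ i, a i * u i) := by
      intro i
      rw [← ih, Finset.mul_sum]
      have h1 : a i * u i = ∑ f, a i * u i * tpow a n f := by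
        rw [← Finset.mul_sum, (ha.tpow n).2, mul_one]
      rw [h1, ← Finset.sum_add_distrib]
      refine Finset.sum_congr rfl fun f _ => ?_
      simp only [tpow, Fin.prod_univ_succ, Fin.sum_univ_succ, Fin.cons_zero, Fin.cons_succ]
      ring
    simp only [h, Finset.sum_add_distrib, ← Finset.sum_mul, ha.2]
    push_cast
    ring

theorem sum_tpow_mul_sum_sq {α : Type*} [Fintype α] {a : α → ℝ} (ha : IsProbDist a) (u : α → ℝ)
    (n : ℕ) : ∑ f, tpow a n f * (∑ j, u (f j)) ^ 2 =
      n * ∑ i, a i * u i ^ 2 + n * (n - 1) * (∑ i, a i * u i) ^ 2 := by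
  induction n with
  | zero => simp
  | succ n ih =>
    rw [sum_pi_succ]
    have h : ∀ i, ∑ f : Fin n → α, tpow a (n + 1) (Fin.cons i f) *
        (∑ j, u ((Fin.cons i f : Fin (n + 1) → α) j)) ^ 2 =
          a i * u i ^ 2 + a i * u i * (2 * (n * ∑ i, a i * u i)) +
            a i * (n * ∑ i, a i * u i ^ 2 + n * (n - 1) * (∑ i, a i * u i) ^ 2) := by
      intro i
      rw [← ih, ← sum_tpow_mul_sum ha u n, Finset.mul_sum, Finset.mul_sum, Finset.mul_sum]
      have h1 : a i * u i ^ 2 = ∑ f, a i * u i ^ 2 * tpow a n f := by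
        rw [← Finset.mul_sum, (ha.tpow n).2, mul_one]
      rw [h1, ← Finset.sum_add_distrib, ← Finset.sum_add_distrib]
      refine Finset.sum_congr rfl fun f _ => ?_
      simp only [tpow, Fin.prod_univ_succ, Fin.sum_univ_succ, Fin.cons_zero, Fin.cons_succ]
      ring
    simp only [h, Finset.sum_add_distrib, ← Finset.sum_mul, ha.2]
    push_cast
    ring

/-! ### Entropies of product distributions -/

theorem tpow_mul_log {α : Type*} (a : α → ℝ) {n : ℕ} (f : Fin n → α) :
    tpow a n f * Real.log (tpow a n f) = tpow a n f * ∑ j, Real.log (a (f j)) := by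
  by_cases h : tpow a n f = 0
  · simp [h]
  · have h' : ∀ j ∈ Finset.univ, a (f j) ≠ 0 := Finset.prod_ne_zero_iff.1 h
    rw [show Real.log (tpow a n f) = ∑ j, Real.log (a (f j)) from Real.log_prod h']

theorem shannonH_tpow {α : Type*} [Fintype α] {a : α → ℝ} (ha : IsProbDist a) (n : ℕ) :
    shannonH (tpow a n) = n * shannonH a := by
  unfold shannonH
  simp only [tpow_mul_log, sum_tpow_mul_sum ha (fun i => Real.log (a i)) n]
  ring

theorem shannonH_tensor {α β : Type*} [Fintype α] [Fintype β] {a : α → ℝ} {b : β → ℝ}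
    (ha : IsProbDist a) (hb : IsProbDist b) :
    shannonH (tensor a b) = shannonH a + shannonH b := by
  have h : ∀ x y, tensor a b (x, y) * Real.log (tensor a b (x, y)) =
      a x * Real.log (a x) * b y + a x * (b y * Real.log (b y)) := by
    intro x y
    simp only [tensor]
    by_cases hx : a x = 0
    · simp [hx]
    by_cases hy : b y = 0
    · simp [hy]
    rw [Real.log_mul hx hy]
    ring
  unfold shannonH
  rw [Fintype.sum_prod_type]
  simp only [h, Finset.sum_add_distrib, ← Finset.mul_sum, ← Finset.sum_mul, ha.2, hb.2]
  ring

theorem shannonH_unif {d : ℕ} (hd : d ≠ 0) : shannonH (unif d) = Real.log d := by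
  have : (d : ℝ) ≠ 0 := by exact_mod_cast hd
  simp [shannonH, unif]
  field_simp

theorem mul_log_div_unif {d : ℕ} (hd : d ≠ 0) {a : Fin d → ℝ} {i : Fin d} (h : a i ≠ 0) :
    Real.log (a i / unif d i) = Real.log (a i) + Real.log d := by
  have : (d : ℝ) ≠ 0 := by exact_mod_cast hd
  rw [unif, div_div_eq_mul_div, div_one, Real.log_mul h this]

theorem relD_unif {d : ℕ} (hd : d ≠ 0) {a : Fin d → ℝ} (ha : IsProbDist a) :
    relD a (unif d) = Real.log d - shannonH a := by
  have h : ∀ i, a i * Real.log (a i / unif d i) =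
      a i * Real.log (a i) + a i * Real.log d := by
    intro i
    by_cases h : a i = 0
    · simp [h]
    · rw [mul_log_div_unif hd h]; ring
  unfold relD shannonH
  simp only [h, Finset.sum_add_distrib, ← Finset.sum_mul, ha.2]
  ring

theorem relV_unif {d : ℕ} (hd : d ≠ 0) {a : Fin d → ℝ} (ha : IsProbDist a) :
    relV a (unif d) = entV a := by
  unfold relV entV
  refine Finset.sum_congr rfl fun i _ => ?_
  by_cases h : a i = 0
  · simp [h]
  · rw [mul_log_div_unif hd h, relD_unif hd ha]; ring

/-! ### Moderate deviations for finitely supported random variables -/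

theorem abs_mgf_sub_le {α : Type*} [Fintype α] {p w : α → ℝ} (hp : IsProbDist p)
    (h1 : ∑ i, p i * w i = 0) {B : ℝ} (hB : ∀ i, |w i| ≤ B) {l : ℝ} (hl : |l| * B ≤ 1) :
    |∑ i, p i * Real.exp (l * w i) - (1 + l ^ 2 * (∑ i, p i * w i ^ 2) / 2)| ≤
      |l| ^ 2 * (|l| * B ^ 3) := by
  have hterm : ∀ i, |Real.exp (l * w i) - (1 + l * w i + (l * w i) ^ 2 / 2)| ≤
      |l| ^ 2 * (|l| * B ^ 3) := by
    intro i
    have hle : |l * w i| ≤ |l| * B := by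
      rw [abs_mul]; exact mul_le_mul_of_nonneg_left (hB i) (abs_nonneg l)
    have h := Real.exp_bound (hle.trans hl) (n := 3) (by norm_num)
    simp only [Finset.sum_range_succ, Finset.sum_range_zero, Nat.factorial] at h
    have h3 : |l * w i| ^ 3 ≤ (|l| * B) ^ 3 := by gcongr
    have h4 : 0 ≤ |l * w i| ^ 3 := by positivity
    norm_num at h
    rw [abs_mul] at h3 h4
    calc _ ≤ (|l| * |w i|) ^ 3 * (2 / 9) := by simpa using h
      _ ≤ (|l| * B) ^ 3 := by linarith
      _ = _ := by ring
  have hsum : ∑ i, p i * Real.exp (l * w i) - (1 + l ^ 2 * (∑ i, p i * w i ^ 2) / 2) =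
      ∑ i, p i * (Real.exp (l * w i) - (1 + l * w i + (l * w i) ^ 2 / 2)) := by
    have h2 : ∀ i, p i * (Real.exp (l * w i) - (1 + l * w i + (l * w i) ^ 2 / 2)) =
        p i * Real.exp (l * w i) - (p i + l * (p i * w i) + l ^ 2 / 2 * (p i * w i ^ 2)) := by
      intro i; ring
    simp only [h2, Finset.sum_sub_distrib, Finset.sum_add_distrib, ← Finset.mul_sum, h1, hp.2]
    ring
  rw [hsum]
  calc _ ≤ ∑ i, |p i * (Real.exp (l * w i) - (1 + l * w i + (l * w i) ^ 2 / 2))| :=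
        Finset.abs_sum_le_sum_abs _ _
    _ ≤ ∑ i, p i * (|l| ^ 2 * (|l| * B ^ 3)) := by
        refine Finset.sum_le_sum fun i _ => ?_
        rw [abs_mul, abs_of_nonneg (hp.1 i)]
        exact mul_le_mul_of_nonneg_left (hterm i) (hp.1 i)
    _ = _ := by rw [← Finset.sum_mul, hp.2, one_mul]

theorem exists_abs_le {α : Type*} [Fintype α] (w : α → ℝ) : ∃ B : ℝ, 0 < B ∧ ∀ i, |w i| ≤ B := by
  refine ⟨1 + ∑ i, |w i|, by positivity, fun i => ?_⟩
  have := Finset.single_le_sum (f := fun i => |w i|) (fun i _ => abs_nonneg _) (Finset.mem_univ i)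
  linarith

/-- Second-order expansion of the moment generating function of a centred variable at `0`. -/
theorem eventually_mgf_bounds {α : Type*} [Fintype α] {p w : α → ℝ} (hp : IsProbDist p)
    (h1 : ∑ i, p i * w i = 0) {V : ℝ} (hV : ∑ i, p i * w i ^ 2 = V) {κ : ℝ} (hκ : 0 < κ) :
    ∀ᶠ l in 𝓝 (0 : ℝ), Real.exp (l ^ 2 * (V / 2 - κ)) ≤ ∑ i, p i * Real.exp (l * w i) ∧
      ∑ i, p i * Real.exp (l * w i) ≤ Real.exp (l ^ 2 * (V / 2 + κ)) := by
  obtain ⟨B, hB0, hB⟩ := exists_abs_le w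
  have small : ∀ (f : ℝ → ℝ), Continuous f → f 0 = 0 → ∀ c : ℝ, 0 < c →
      ∀ᶠ l in 𝓝 (0 : ℝ), f l ≤ c := by
    intro f hf h0 c hc
    have := hf.tendsto 0
    rw [h0] at this
    exact this.eventually_le_const hc
  filter_upwards [small (fun l => |l| * B) (by fun_prop) (by simp) 1 one_pos,
    small (fun l => |l| * B ^ 3) (by fun_prop) (by simp) (κ / 2) (by positivity),
    small (fun l => l ^ 2 * (V / 2 - κ) ^ 2) (by fun_prop) (by simp) (κ / 2) (by positivity),
    small (fun l => |l ^ 2 * (V / 2 - κ)|) (by fun_prop) (by simp) 1 one_pos] with l hl1 hl2 hl3 hl4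
  have h := abs_le.1 (abs_mgf_sub_le hp h1 hB hl1)
  rw [hV, sq_abs] at h
  have hc : l ^ 2 * (|l| * B ^ 3) ≤ l ^ 2 * (κ / 2) :=
    mul_le_mul_of_nonneg_left hl2 (sq_nonneg l)
  have hlκ : 0 ≤ l ^ 2 * κ := by positivity
  constructor
  · have he := (abs_le.1 (Real.abs_exp_sub_one_sub_id_le hl4)).2
    have hs : (l ^ 2 * (V / 2 - κ)) ^ 2 ≤ l ^ 2 * (κ / 2) := by
      calc (l ^ 2 * (V / 2 - κ)) ^ 2 = l ^ 2 * (l ^ 2 * (V / 2 - κ) ^ 2) := by ring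
        _ ≤ _ := mul_le_mul_of_nonneg_left hl3 (sq_nonneg l)
    linarith [h.1]
  · have he := Real.add_one_le_exp (l ^ 2 * (V / 2 + κ))
    linarith [h.2]

theorem one_le_mgf {α : Type*} [Fintype α] {p w : α → ℝ} (hp : IsProbDist p)
    (h1 : ∑ i, p i * w i = 0) (l : ℝ) : 1 ≤ ∑ i, p i * Real.exp (l * w i) := by
  calc (1 : ℝ) = ∑ i, p i * (l * w i + 1) := by
        have : ∀ i, p i * (l * w i + 1) = l * (p i * w i) + p i := fun i => by ring
        simp only [this, Finset.sum_add_distrib, ← Finset.mul_sum, h1, hp.2, mul_zero, zero_add]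
    _ ≤ _ := Finset.sum_le_sum fun i _ =>
        mul_le_mul_of_nonneg_left (Real.add_one_le_exp _) (hp.1 i)

theorem sum_tpow_mul_exp {α : Type*} [Fintype α] (p w : α → ℝ) (l : ℝ) (n : ℕ) :
    ∑ f, tpow p n f * Real.exp (l * ∑ j, w (f j)) = (∑ i, p i * Real.exp (l * w i)) ^ n := by
  rw [Fintype.sum_pow]
  refine Finset.sum_congr rfl fun f _ => ?_
  rw [Finset.mul_sum, Real.exp_sum, tpow, ← Finset.prod_mul_distrib]

/-- Markov's inequality for the exponential of a sum of independent variables. -/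
theorem sum_filter_tpow_le_exp_mul_mgf {α : Type*} [Fintype α] {p : α → ℝ} (hp : IsProbDist p)
    (w : α → ℝ) (n : ℕ) {l : ℝ} (hl : 0 ≤ l) (c : ℝ) :
    ∑ f ∈ Finset.univ.filter (fun f : Fin n → α => ∑ j, w (f j) ≤ -c), tpow p n f ≤
      Real.exp (-(l * c)) * (∑ i, p i * Real.exp (-l * w i)) ^ n := by
  rw [← sum_tpow_mul_exp, Finset.mul_sum]
  have h0 := (hp.tpow n).1
  refine (Finset.sum_le_sum fun f hf => ?_).trans
    (Finset.sum_le_sum_of_subset_of_nonneg (Finset.subset_univ _)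
      fun f _ _ => mul_nonneg (Real.exp_pos _).le (mul_nonneg (h0 f) (Real.exp_pos _).le))
  have hf' := (Finset.mem_filter.1 hf).2
  have h1 : 1 ≤ Real.exp (-(l * c)) * Real.exp (-l * ∑ j, w (f j)) := by
    rw [← Real.exp_add]
    apply Real.one_le_exp
    nlinarith
  nlinarith [h0 f]

theorem ModerateSeq.eventually_pos {t : ℕ → ℝ} (ht : ModerateSeq t) : ∀ᶠ n in atTop, 0 < t n := by
  filter_upwards [ht.2.eventually_gt_atTop 0] with n hn
  by_contra! h
  nlinarith [Real.sqrt_nonneg (n : ℝ)]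

theorem ModerateSeq.tendsto_mul_sq {t : ℕ → ℝ} (ht : ModerateSeq t) :
    Tendsto (fun n : ℕ => (n : ℝ) * t n ^ 2) atTop atTop := by
  have h := ht.2.atTop_mul_atTop₀ ht.2
  refine h.congr fun n => ?_
  rw [show (Real.sqrt n * t n) * (Real.sqrt n * t n) = Real.sqrt n * Real.sqrt n * t n ^ 2 by ring,
    Real.mul_self_sqrt (Nat.cast_nonneg n)]

theorem ModerateSeq.tendsto_const_mul {t : ℕ → ℝ} (ht : ModerateSeq t) (c : ℝ) :
    Tendsto (fun n => c * t n) atTop (𝓝 0) := by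
  simpa using ht.1.const_mul c

/-- Moderate deviation upper bound. -/
theorem eventually_sum_filter_tpow_lt {α : Type*} [Fintype α] {p w : α → ℝ} (hp : IsProbDist p)
    (h1 : ∑ i, p i * w i = 0) {V : ℝ} (hV : ∑ i, p i * w i ^ 2 = V) (hV0 : 0 < V)
    {t : ℕ → ℝ} (ht : ModerateSeq t) {a b : ℝ} (hb : 0 ≤ b) (hab : b < a) :
    ∀ᶠ n : ℕ in atTop,
      ∑ f ∈ Finset.univ.filter (fun f : Fin n → α => ∑ j, w (f j) ≤ -(a * n * t n)),
        tpow p n f < Real.exp (-(b ^ 2 / (2 * V)) * (n * t n ^ 2)) := by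
  have ha : 0 < a := hb.trans_lt hab
  have hab2 : 0 < a ^ 2 - b ^ 2 := by nlinarith
  have hκ : 0 < (a ^ 2 - b ^ 2) * V / (4 * a ^ 2) := by positivity
  filter_upwards [(ht.tendsto_const_mul (-(a / V))).eventually (eventually_mgf_bounds hp h1 hV hκ),
    ht.eventually_pos, ht.tendsto_mul_sq.eventually_gt_atTop 0] with n hM htn hn
  have hl : 0 ≤ a / V * t n := by positivity
  refine (sum_filter_tpow_le_exp_mul_mgf hp w n hl (a * n * t n)).trans_lt ?_
  rw [show -(a / V * t n) = -(a / V) * t n from (neg_mul _ _).symm]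
  have hM0 : 0 ≤ ∑ i, p i * Real.exp (-(a / V) * t n * w i) :=
    zero_le_one.trans (one_le_mgf hp h1 _)
  calc _ ≤ Real.exp (-(a / V * t n * (a * n * t n))) *
        Real.exp ((-(a / V) * t n) ^ 2 * (V / 2 + (a ^ 2 - b ^ 2) * V / (4 * a ^ 2))) ^ n := by
        gcongr
        exact hM.2
    _ = Real.exp (-((a ^ 2 + b ^ 2) / (4 * V)) * (n * t n ^ 2)) := by
        rw [← Real.exp_nat_mul, ← Real.exp_add]
        congr 1
        field_simp
        ring
    _ < _ := by
        apply Real.exp_lt_exp.2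
        apply mul_lt_mul_of_pos_right _ hn
        rw [neg_lt_neg_iff, div_lt_div_iff₀ (by positivity) (by positivity)]
        nlinarith [mul_pos hV0 hab2]

/-- The exponential tilt of `p` by `w`. -/
def tilt {α : Type*} [Fintype α] (p w : α → ℝ) (l : ℝ) : α → ℝ :=
  fun i => p i * Real.exp (l * w i) / ∑ k, p k * Real.exp (l * w k)

theorem isProbDist_tilt {α : Type*} [Fintype α] {p w : α → ℝ} (hp : IsProbDist p)
    (h1 : ∑ i, p i * w i = 0) (l : ℝ) : IsProbDist (tilt p w l) := by
  have hM := zero_lt_one.trans_le (one_le_mgf hp h1 l)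
  refine ⟨fun i => div_nonneg (mul_nonneg (hp.1 i) (Real.exp_pos _).le) hM.le, ?_⟩
  simp only [tilt, ← Finset.sum_div]
  exact div_self hM.ne'

theorem tpow_eq_mul_tpow_tilt {α : Type*} [Fintype α] {p w : α → ℝ} (hp : IsProbDist p)
    (h1 : ∑ i, p i * w i = 0) (l : ℝ) {n : ℕ} (f : Fin n → α) :
    tpow p n f = (∑ i, p i * Real.exp (l * w i)) ^ n * Real.exp (-(l * ∑ j, w (f j))) *
      tpow (tilt p w l) n f := by
  have hM := zero_lt_one.trans_le (one_le_mgf hp h1 l)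
  have h : tpow (tilt p w l) n f =
      tpow p n f * Real.exp (l * ∑ j, w (f j)) / (∑ i, p i * Real.exp (l * w i)) ^ n := by
    simp only [tpow, tilt]
    rw [Finset.prod_div_distrib, Finset.prod_mul_distrib, Finset.mul_sum, Real.exp_sum]
    simp
  rw [h, Real.exp_neg]
  field_simp

/-- The tilted mean of a centred variable is `l * V` to first order. -/
theorem abs_sum_tilt_mul_sub_le {α : Type*} [Fintype α] {p w : α → ℝ} (hp : IsProbDist p)
    (h1 : ∑ i, p i * w i = 0) {V : ℝ} (hV : ∑ i, p i * w i ^ 2 = V) (hV0 : 0 ≤ V)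
    {B : ℝ} (hB : ∀ i, |w i| ≤ B) {l : ℝ} (hl0 : 0 ≤ l) (hl1 : l ≤ 1) (hlB : l * B ≤ 1) :
    |∑ i, tilt p w l i * (w i - l * V)| ≤ l ^ 2 * (B ^ 2 * (B + V)) := by
  have hM := one_le_mgf hp h1 l
  have hsum : ∑ i, p i * Real.exp (l * w i) * (w i - l * V) =
      ∑ i, p i * ((Real.exp (l * w i) - 1 - l * w i) * (w i - l * V)) := by
    have h2 : ∀ i, p i * ((Real.exp (l * w i) - 1 - l * w i) * (w i - l * V)) =
        p i * Real.exp (l * w i) * (w i - l * V) -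
          (p i * w i - p i * (l * V) + l * (p i * w i ^ 2) - l ^ 2 * V * (p i * w i)) := by
      intro i; ring
    simp only [h2, Finset.sum_sub_distrib, Finset.sum_add_distrib, ← Finset.mul_sum,
      ← Finset.sum_mul, h1, hp.2, hV]
    ring
  have hnum : |∑ i, p i * Real.exp (l * w i) * (w i - l * V)| ≤ l ^ 2 * (B ^ 2 * (B + V)) := by
    rw [hsum]
    calc _ ≤ ∑ i, |p i * ((Real.exp (l * w i) - 1 - l * w i) * (w i - l * V))| :=
          Finset.abs_sum_le_sum_abs _ _
      _ ≤ ∑ i, p i * (l ^ 2 * (B ^ 2 * (B + V))) := by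
          refine Finset.sum_le_sum fun i _ => ?_
          rw [abs_mul, abs_of_nonneg (hp.1 i), abs_mul]
          refine mul_le_mul_of_nonneg_left ?_ (hp.1 i)
          have hle : |l * w i| ≤ l * B := by
            rw [abs_mul, abs_of_nonneg hl0]; exact mul_le_mul_of_nonneg_left (hB i) hl0
          have he := Real.abs_exp_sub_one_sub_id_le (hle.trans hlB)
          have hsq : (l * w i) ^ 2 ≤ l ^ 2 * B ^ 2 := by
            rw [← sq_abs, ← mul_pow]; gcongr
          have hw : |w i - l * V| ≤ B + V := by
            have hlV : l * V ≤ V := mul_le_of_le_one_left hV0 hl1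
            have hlV0 : 0 ≤ l * V := mul_nonneg hl0 hV0
            have := abs_le.1 (hB i)
            exact abs_le.2 ⟨by linarith, by linarith⟩
          calc _ ≤ l ^ 2 * B ^ 2 * (B + V) :=
                mul_le_mul (he.trans hsq) hw (abs_nonneg _) (by positivity)
            _ = _ := by ring
      _ = _ := by rw [← Finset.sum_mul, hp.2, one_mul]
  have heq : ∑ i, tilt p w l i * (w i - l * V) =
      (∑ i, p i * Real.exp (l * w i) * (w i - l * V)) / ∑ i, p i * Real.exp (l * w i) := by
    rw [Finset.sum_div]
    exact Finset.sum_congr rfl fun i _ => by rw [tilt]; ring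
  rw [heq, abs_div, abs_of_nonneg (zero_le_one.trans hM)]
  exact (div_le_self (abs_nonneg _) hM).trans hnum

/-- Chebyshev's inequality for sums of independent, not necessarily centred variables. -/
theorem sum_filter_tpow_mul_sq_le {α : Type*} [Fintype α] {r : α → ℝ} (hr : IsProbDist r)
    {u : α → ℝ} {C e : ℝ} (hC : ∀ i, |u i| ≤ C) (he : |∑ i, r i * u i| ≤ e) (n : ℕ) {s : ℝ}
    (hs : 0 ≤ s) :
    (∑ f ∈ Finset.univ.filter (fun f : Fin n → α => s ≤ |∑ j, u (f j)|), tpow r n f) * s ^ 2 ≤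
      n * C ^ 2 + n ^ 2 * e ^ 2 := by
  have h0 := (hr.tpow n).1
  have hu2 : ∑ i, r i * u i ^ 2 ≤ C ^ 2 := by
    calc _ ≤ ∑ i, r i * C ^ 2 := Finset.sum_le_sum fun i _ => by
          refine mul_le_mul_of_nonneg_left ?_ (hr.1 i)
          rw [← sq_abs]
          exact pow_le_pow_left₀ (abs_nonneg _) (hC i) 2
      _ = _ := by rw [← Finset.sum_mul, hr.2, one_mul]
  have hu1 : (∑ i, r i * u i) ^ 2 ≤ e ^ 2 := by
    rw [← sq_abs]
    exact pow_le_pow_left₀ (abs_nonneg _) he 2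
  calc _ = ∑ f ∈ Finset.univ.filter (fun f : Fin n → α => s ≤ |∑ j, u (f j)|),
        tpow r n f * s ^ 2 := Finset.sum_mul _ _ _
    _ ≤ ∑ f ∈ Finset.univ.filter (fun f : Fin n → α => s ≤ |∑ j, u (f j)|),
        tpow r n f * (∑ j, u (f j)) ^ 2 := by
        refine Finset.sum_le_sum fun f hf => mul_le_mul_of_nonneg_left ?_ (h0 f)
        rw [← sq_abs (∑ j, u (f j))]
        exact pow_le_pow_left₀ hs (Finset.mem_filter.1 hf).2 2
    _ ≤ ∑ f, tpow r n f * (∑ j, u (f j)) ^ 2 :=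
        Finset.sum_le_sum_of_subset_of_nonneg (Finset.subset_univ _)
          fun f _ _ => mul_nonneg (h0 f) (sq_nonneg _)
    _ = n * ∑ i, r i * u i ^ 2 + n * (n - 1) * (∑ i, r i * u i) ^ 2 :=
        sum_tpow_mul_sum_sq hr u n
    _ ≤ _ := by
        have hn : (0 : ℝ) ≤ n := Nat.cast_nonneg n
        have ha := mul_le_mul_of_nonneg_left hu2 hn
        have hb := mul_le_mul_of_nonneg_left hu1 (sq_nonneg (n : ℝ))
        nlinarith [mul_nonneg hn (sq_nonneg (∑ i, r i * u i))]

/-- Moderate deviation lower bound. -/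
theorem eventually_lt_sum_filter_tpow {α : Type*} [Fintype α] {p w : α → ℝ} (hp : IsProbDist p)
    (h1 : ∑ i, p i * w i = 0) {V : ℝ} (hV : ∑ i, p i * w i ^ 2 = V) (hV0 : 0 < V)
    {t : ℕ → ℝ} (ht : ModerateSeq t) {a b : ℝ} (ha : 0 ≤ a) (hab : a < b) :
    ∀ᶠ n : ℕ in atTop, Real.exp (-(b ^ 2 / (2 * V)) * (n * t n ^ 2)) <
      ∑ f ∈ Finset.univ.filter (fun f : Fin n → α => a * n * t n < ∑ j, w (f j)),
        tpow p n f := by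
  obtain ⟨B, hB0, hB⟩ := exists_abs_le w
  obtain ⟨c, hc⟩ : ∃ c, c = (a + b) / 2 := ⟨_, rfl⟩
  obtain ⟨δ, hδ⟩ : ∃ δ, δ = (b - a) / 2 := ⟨_, rfl⟩
  have hc0 : 0 < c := by linarith
  have hδ0 : 0 < δ := by linarith
  have hκ : 0 < δ ^ 2 * V / (4 * c ^ 2) := by positivity
  have hcV : 0 < c / V := by positivity
  have htend := ht.tendsto_const_mul (c / V)
  have hnt := ht.tendsto_mul_sq
  filter_upwards [htend.eventually (eventually_mgf_bounds hp h1 hV hκ),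
    ht.eventually_pos, hnt.eventually_gt_atTop 0,
    htend.eventually_le_const one_pos,
    htend.eventually_le_const (inv_pos.2 hB0),
    (ht.tendsto_const_mul ((c / V) ^ 2 * (B ^ 2 * (B + V)))).eventually_le_const
      (half_pos hδ0),
    hnt.eventually_ge_atTop (4 * (B + V) ^ 2 / δ ^ 2),
    hnt.eventually_gt_atTop (Real.log 2 * (4 * V) / δ ^ 2)]
    with n hM htn hn hl1 hlB he hC hlog
  obtain ⟨l, hl⟩ : ∃ l, l = c / V * t n := ⟨_, rfl⟩
  rw [← hl] at hM hl1 hlB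
  have hl0 : 0 < l := by rw [hl]; positivity
  have hlV : l * V = c * t n := by rw [hl]; field_simp
  have hlB' : l * B ≤ 1 := by rwa [← le_div_iff₀ hB0, one_div]
  have hr := isProbDist_tilt (w := w) hp h1 l
  have hmean : |∑ i, tilt p w l i * (w i - l * V)| ≤ δ / 2 * t n := by
    refine (abs_sum_tilt_mul_sub_le hp h1 hV hV0.le hB hl0.le hl1 hlB').trans ?_
    calc l ^ 2 * (B ^ 2 * (B + V)) = (c / V) ^ 2 * (B ^ 2 * (B + V)) * t n * t n := by
          rw [hl]; ring
      _ ≤ _ := mul_le_mul_of_nonneg_right he htn.le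
  have hu : ∀ i, |w i - l * V| ≤ B + V := by
    intro i
    have hlV1 : l * V ≤ V := mul_le_of_le_one_left hV0.le hl1
    have hlV0 : 0 ≤ l * V := by positivity
    have := abs_le.1 (hB i)
    exact abs_le.2 ⟨by linarith, by linarith⟩
  have hn0 : (0 : ℝ) < n := by
    rcases Nat.eq_zero_or_pos n with h | h
    · simp [h] at hn
    · exact_mod_cast h
  have hs0 : 0 < δ * n * t n := by positivity
  have hcheb := sum_filter_tpow_mul_sq_le hr hu hmean n hs0.le
  have hfar : ∑ f ∈ Finset.univ.filter (fun f : Fin n → α =>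
      δ * n * t n ≤ |∑ j, (w (f j) - l * V)|), tpow (tilt p w l) n f ≤ 1 / 2 := by
    rw [← mul_le_mul_iff_of_pos_right (pow_pos hs0 2)]
    refine hcheb.trans ?_
    rw [div_le_iff₀ (by positivity)] at hC
    nlinarith [mul_le_mul_of_nonneg_left hC hn0.le]
  have hnear : 1 / 2 ≤ ∑ f ∈ Finset.univ.filter (fun f : Fin n → α =>
      ¬ δ * n * t n ≤ |∑ j, (w (f j) - l * V)|), tpow (tilt p w l) n f := by
    have := Finset.sum_filter_add_sum_filter_not Finset.univ (fun f : Fin n → α =>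
      δ * n * t n ≤ |∑ j, (w (f j) - l * V)|) (tpow (tilt p w l) n)
    rw [(hr.tpow n).2] at this
    linarith
  have hexp : Real.exp (-(b ^ 2 / (2 * V)) * (n * t n ^ 2)) <
      Real.exp (l ^ 2 * (V / 2 - δ ^ 2 * V / (4 * c ^ 2))) ^ n *
        Real.exp (-(l * (b * n * t n))) * (1 / 2) := by
    rw [← Real.exp_nat_mul, ← Real.exp_add, one_div,
      show (2 : ℝ)⁻¹ = Real.exp (-Real.log 2) by rw [Real.exp_neg, Real.exp_log two_pos],
      ← Real.exp_add, Real.exp_lt_exp]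
    rw [div_lt_iff₀ (by positivity)] at hlog
    have hb : b = c + δ := by rw [hc, hδ]; ring
    have hid : (n : ℝ) * (l ^ 2 * (V / 2 - δ ^ 2 * V / (4 * c ^ 2))) + -(l * (b * n * t n)) =
        -(b ^ 2 / (2 * V)) * (n * t n ^ 2) + (n * t n ^ 2) * δ ^ 2 / (4 * V) := by
      rw [hl, hb]
      field_simp
      ring
    rw [hid]
    have : Real.log 2 < (n * t n ^ 2) * δ ^ 2 / (4 * V) := by
      rwa [lt_div_iff₀ (by positivity)]
    linarith
  have hM0 : 0 ≤ ∑ i, p i * Real.exp (l * w i) := zero_le_one.trans (one_le_mgf hp h1 l)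
  have hwin : ∀ f : Fin n → α, ¬ δ * n * t n ≤ |∑ j, (w (f j) - l * V)| →
      a * n * t n < ∑ j, w (f j) ∧ ∑ j, w (f j) ≤ b * n * t n := by
    intro f hf
    rw [not_le, Finset.sum_sub_distrib, Finset.sum_const, Finset.card_univ, Fintype.card_fin,
      nsmul_eq_mul, hlV, abs_lt, hδ, hc] at hf
    constructor <;> linarith [hf.1, hf.2]
  calc _ < _ := hexp
    _ ≤ (∑ i, p i * Real.exp (l * w i)) ^ n * Real.exp (-(l * (b * n * t n))) *
        ∑ f ∈ Finset.univ.filter (fun f : Fin n → α =>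
          ¬ δ * n * t n ≤ |∑ j, (w (f j) - l * V)|), tpow (tilt p w l) n f := by
        gcongr
        exact hM.1
    _ ≤ ∑ f ∈ Finset.univ.filter (fun f : Fin n → α =>
          ¬ δ * n * t n ≤ |∑ j, (w (f j) - l * V)|), tpow p n f := by
        rw [Finset.mul_sum]
        refine Finset.sum_le_sum fun f hf => ?_
        rw [tpow_eq_mul_tpow_tilt hp h1 l f]
        have hle := (hwin f (Finset.mem_filter.1 hf).2).2
        have := (hr.tpow n).1 f
        gcongr
    _ ≤ _ := by
        refine Finset.sum_le_sum_of_subset_of_nonneg (fun f hf => ?_)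
          fun f _ _ => (hp.tpow n).1 f
        exact Finset.mem_filter.2 ⟨Finset.mem_univ _, (hwin f (Finset.mem_filter.1 hf).2).1⟩

/-! ### The cut-and-pile error -/

theorem sum_mul_log_add_shannonH {α : Type*} [Fintype α] {p : α → ℝ} (hp : IsProbDist p) :
    ∑ i, p i * (Real.log (p i) + shannonH p) = 0 := by
  simp only [mul_add, Finset.sum_add_distrib, ← Finset.sum_mul, hp.2]
  simp [shannonH]

theorem tpow_unif {d m : ℕ} (hd : d ≠ 0) (g : Fin m → Fin d) :
    tpow (unif d) m g = Real.exp (-(m * Real.log d)) := by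
  have : (0 : ℝ) < d := by positivity
  simp only [tpow, unif, Finset.prod_const, Finset.card_univ, Fintype.card_fin]
  rw [← mul_neg, Real.exp_nat_mul, Real.exp_neg, Real.exp_log this, one_div]

theorem tpow_eq_exp {α : Type*} [Fintype α] {p : α → ℝ} (hp : IsProbDist p) {n : ℕ}
    {f : Fin n → α} (hf : tpow p n f ≠ 0) :
    tpow p n f =
      Real.exp (∑ j, (Real.log (p (f j)) + shannonH p) - n * shannonH p) := by
  have h : ∀ j, p (f j) ≠ 0 := fun j => Finset.prod_ne_zero_iff.1 hf j (Finset.mem_univ j)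
  rw [Finset.sum_add_distrib]
  simp only [Finset.sum_const, Finset.card_univ, Fintype.card_fin, nsmul_eq_mul,
    add_sub_cancel_right]
  rw [Real.exp_sum]
  exact Finset.prod_congr rfl fun j _ => (Real.exp_log ((hp.1 _).lt_of_ne' (h j))).symm

theorem tailSum_tensor_le {d : ℕ} (hd : d ≠ 0) {p : Fin d → ℝ} (hp : IsProbDist p) {n m : ℕ}
    {K y : ℝ} (hK : Real.exp (n * shannonH p + m * Real.log d + y) ≤ K) :
    tailSum (tensor (tpow p n) (tpow (unif d) m)) K ≤
      ∑ f ∈ Finset.univ.filter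
        (fun f : Fin n → Fin d => ∑ j, (Real.log (p (f j)) + shannonH p) ≤ -y), tpow p n f := by
  have hu := (isProbDist_unif hd).tpow m
  have hK0 : 0 < K := (Real.exp_pos _).trans_le hK
  refine (tailSum_le_sum_filter ((hp.tpow n).tensor hu) hK0).trans ?_
  rw [Finset.sum_filter, Finset.sum_filter, Fintype.sum_prod_type]
  refine Finset.sum_le_sum fun f _ => ?_
  rw [← mul_one (if _ ≤ -y then _ else _), ← congrArg (_ * ·) hu.2, Finset.mul_sum]
  refine Finset.sum_le_sum fun g _ => ?_
  by_cases hf : tpow p n f = 0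
  · simp [tensor, hf]
  have hf0 := (hp.tpow n).1 f
  have hg0 := hu.1 g
  split_ifs with h h'
  · exact le_rfl
  · refine absurd ?_ h'
    have h1 : tensor (tpow p n) (tpow (unif d) m) (f, g) ≤
        Real.exp (-(n * shannonH p + m * Real.log d + y)) := by
      refine h.trans ?_
      rw [Real.exp_neg, one_div]
      exact inv_anti₀ (Real.exp_pos _) hK
    simp only [tensor] at h1
    rw [tpow_eq_exp hp hf, tpow_unif hd, ← Real.exp_add, Real.exp_le_exp] at h1
    linarith
  · positivity
  · simp

/-- Total variation error of the cut-and-pile construction. -/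
theorem cut_and_pile_error
    {d : ℕ} (hd : 2 ≤ d) (p q : Fin d → ℝ) (hp : IsProbDist p) (hq : IsProbDist q)
    (hDp : 0 < relD p (unif d)) (hDq : 0 < relD q (unif d))
    (hVp : 0 < relV p (unif d)) (hVq : 0 < relV q (unif d))
    (t : ℕ → ℝ) (ht : ModerateSeq t)
    (μ : ℝ) (hμ : μ ≠ 0)
    (ν : ℝ)
    (hν : ν = (relV p (unif d) / relD p (unif d)) / (relV q (unif d) / relD q (unif d)))
    (hν1 : μ < 0 → ν ≠ 1)
    (m : ℕ → ℕ)
    (hm : ∀ n : ℕ, m n = ⌊(n : ℝ) * ((relD p (unif d) + μ * t n) / relD q (unif d))⌋₊)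
    (K : ℕ → ℝ → ℝ)
    (hK : ∀ n : ℕ, ∀ x : ℝ, K n x =
      Real.exp (shannonH (tensor (tpow q (m n)) (tpow (unif d) n)) + x * n * t n))
    (z : ℝ)
    (hz1 : μ < 0 → ν < 1 → z = 2 * μ - μ / (1 - Real.sqrt ν))
    (hz2 : μ < 0 → 1 < ν → z = μ / (1 - Real.sqrt ν))
    (hz3 : 0 < μ → z = μ / (1 + Real.sqrt ν)) :
    ∃ ζ₀ > (0 : ℝ), ∀ ζ : ℝ, 0 < ζ → ζ ≤ ζ₀ →
      (μ < 0 → ∃ N : ℕ, ∀ n ≥ N,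
        tvd (cutAndPile (tensor (tpow p n) (tpow (unif d) (m n))) (K n (z - ζ)))
            (descSorted (tensor (tpow p n) (tpow (unif d) (m n)))) <
          Real.exp (-((z - μ - 2 * ζ) ^ 2 / (2 * relV p (unif d))) * ((n : ℝ) * t n ^ 2))) ∧
      (0 < μ → ∃ N : ℕ, ∀ n ≥ N,
        tvd (cutAndPile (tensor (tpow p n) (tpow (unif d) (m n))) (K n (z - ζ)))
            (descSorted (tensor (tpow p n) (tpow (unif d) (m n)))) <
          1 - Real.exp (-((z - μ - 2 * ζ) ^ 2 / (2 * relV p (unif d))) * ((n : ℝ) * t n ^ 2))) := by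
  have hd0 : d ≠ 0 := by omega
  have hV : ∑ i, p i * (Real.log (p i) + shannonH p) ^ 2 = relV p (unif d) :=
    (relV_unif hd0 hp).symm
  have h1 := sum_mul_log_add_shannonH hp
  have hν0 : 0 < ν := by rw [hν]; positivity
  have hsν : 0 < Real.sqrt ν := Real.sqrt_pos.2 hν0
  have hzneg : μ < 0 → 0 < z - μ := by
    intro hμ0
    rcases lt_or_gt_of_ne (hν1 hμ0) with h | h
    · have hs : 0 < 1 - Real.sqrt ν := by
        rw [sub_pos, Real.sqrt_lt' one_pos]; simpa using h
      rw [hz1 hμ0 h, show 2 * μ - μ / (1 - Real.sqrt ν) - μ =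
        -μ * Real.sqrt ν / (1 - Real.sqrt ν) by field_simp; ring]
      exact div_pos (mul_pos (neg_pos.2 hμ0) hsν) hs
    · have hs : 0 < Real.sqrt ν - 1 := by
        rw [sub_pos, Real.lt_sqrt zero_le_one]; simpa using h
      have hs' : 1 - Real.sqrt ν ≠ 0 := by linarith
      rw [hz2 hμ0 h, show μ / (1 - Real.sqrt ν) - μ =
        -μ * Real.sqrt ν / (Real.sqrt ν - 1) by field_simp; ring]
      exact div_pos (mul_pos (neg_pos.2 hμ0) hsν) hs
  have hzpos : 0 < μ → 0 < μ - z := by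
    intro hμ0
    rw [hz3 hμ0, show μ - μ / (1 + Real.sqrt ν) = μ * Real.sqrt ν / (1 + Real.sqrt ν) by
      field_simp; ring]
    positivity
  have hcut : ∀ ζ : ℝ, ∀ᶠ n : ℕ in atTop,
      tvd (cutAndPile (tensor (tpow p n) (tpow (unif d) (m n))) (K n (z - ζ)))
        (descSorted (tensor (tpow p n) (tpow (unif d) (m n)))) ≤
      ∑ f ∈ Finset.univ.filter (fun f : Fin n → Fin d =>
        ∑ j, (Real.log (p (f j)) + shannonH p) ≤ -((z - ζ - μ) * n * t n)), tpow p n f := by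
    intro ζ
    have hpos : ∀ᶠ n in atTop, -relD p (unif d) < μ * t n :=
      (ht.tendsto_const_mul μ).eventually_const_lt (by linarith)
    filter_upwards [hpos] with n hn
    refine (tvd_cutAndPile_le_tailSum
      ((hp.tpow n).tensor ((isProbDist_unif hd0).tpow (m n))) _).trans
      (tailSum_tensor_le hd0 hp ?_)
    have hfloor : (m n : ℝ) ≤ (n : ℝ) * ((relD p (unif d) + μ * t n) / relD q (unif d)) := by
      rw [hm n]
      exact Nat.floor_le (mul_nonneg (Nat.cast_nonneg n) (div_nonneg (by linarith) hDq.le))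
    rw [← mul_div_assoc, le_div_iff₀ hDq, relD_unif hd0 hp, relD_unif hd0 hq] at hfloor
    rw [hK, Real.exp_le_exp, shannonH_tensor (hq.tpow _) ((isProbDist_unif hd0).tpow _),
      shannonH_tpow hq, shannonH_tpow (isProbDist_unif hd0), shannonH_unif hd0]
    linarith
  refine ⟨if μ < 0 then (z - μ) / 2 else 1, ?_, fun ζ hζ hζ₀ => ⟨fun hμ0 => ?_, fun hμ0 => ?_⟩⟩
  · split_ifs with hμ0
    · exact half_pos (hzneg hμ0)
    · exact one_pos
  · rw [if_pos hμ0] at hζ₀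
    rw [← eventually_atTop]
    filter_upwards [hcut ζ, eventually_sum_filter_tpow_lt hp h1 hV hVp ht
      (a := z - ζ - μ) (b := z - μ - 2 * ζ) (by linarith) (by linarith)] with n hn hlt
    exact hn.trans_lt hlt
  · have hz := hzpos hμ0
    rw [← eventually_atTop]
    filter_upwards [hcut ζ, eventually_lt_sum_filter_tpow hp h1 hV hVp ht
      (a := -(z - ζ - μ)) (b := -(z - μ - 2 * ζ)) (by linarith) (by linarith)] with n hn hlt
    have hsplit := Finset.sum_filter_add_sum_filter_not Finset.univ (fun f : Fin n → Fin d =>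
      ∑ j, (Real.log (p (f j)) + shannonH p) ≤ -((z - ζ - μ) * n * t n)) (tpow p n)
    simp only [not_le, (hp.tpow n).2] at hsplit
    simp only [neg_mul, neg_sq] at hlt ⊢
    linarith
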